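/- Let D = (a,b) with a < b, set |D| := b − a, and let (X_t)_{t∈[0,1]} be a zero-mean Gaussian process with càdlàg paths, X_0 = 0, X_t non-degenerate for every t ∈ (0,1], and μ_t < ∞ for every t ∈ (0,1]. For t ∈ (0,1] define Err_Q(t) := 2∫_{|D|}^∞ ℙ(sup_{0≤s≤t} X_s > u) du + ∫_a^b ℙ(sup_{0≤s≤t} X_s ≥ b−x and inf_{0≤s≤t} X_s ≤ a−x) dx. Then for every t ∈ (0,1] with μ_t < |D|/2: (b−a) − Q_D(t) = 2μ_t − Err_Q(t), and 0 < Err_Q(t) ≤ (4σ_t²/(|D|−μ_t)) exp(−(|D|−μ_t)²/(2σ_t²)) + (4σ_t²/(|D|/2−μ_t)) exp(−(|D|/2−μ_t)²/(2σ_t²)). -/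

import Mathlib

open MeasureTheory ProbabilityTheory Filter Set

/-- A real-valued function on `[0,1]` is càdlàg: right-continuous on `[0,1)` and
with left limits on `(0,1]`. -/
def IsCadlagPath (f : ℝ → ℝ) : Prop :=
  (∀ t ∈ Set.Ico (0:ℝ) 1, ContinuousWithinAt f (Set.Ici t) t) ∧
  (∀ t ∈ Set.Ioc (0:ℝ) 1, ∃ l, Filter.Tendsto f (nhdsWithin t (Set.Iio t)) (nhds l))

/-- `(X_t)_{t∈[0,1]}` is a zero-mean Gaussian process: every finite linear combination
`∑ᵢ cᵢ X_{tᵢ}` has a centered Gaussian distribution. -/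
def IsZeroMeanGaussianProcess {Ω : Type*} [MeasureSpace Ω] (X : ℝ → Ω → ℝ) : Prop :=
  ∀ (n : ℕ) (ts : Fin n → ℝ), (∀ i, ts i ∈ Set.Icc (0:ℝ) 1) → ∀ (c : Fin n → ℝ),
    ∃ v : NNReal, Measure.map (fun ω => ∑ i, c i * X (ts i) ω) ℙ =
      ProbabilityTheory.gaussianReal 0 v

lemma volume_image_affine {s : ℝ} (hs : 0 < s) (c : ℝ) (K : Set ℝ) :
    volume ((fun x => s * x + c) '' K) = ENNReal.ofReal s * volume K := by
  have : (fun x => s * x + c) '' K = (fun x => x + c) '' ((s • · : ℝ → ℝ) '' K) := by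
    simp [Set.image_image]
  rw [this, Set.image_smul]
  simp [Measure.addHaar_smul, abs_of_pos hs]

/-- One-dimensional Brunn–Minkowski inequality for weighted sums of compact sets. -/
lemma volume_weighted_sum_compact {s t : ℝ} (hs : 0 < s) (ht : 0 < t) {K L S : Set ℝ}
    (hK : IsCompact K) (hL : IsCompact L) (hK0 : K.Nonempty) (hL0 : L.Nonempty)
    (hS : ∀ x ∈ K, ∀ y ∈ L, s * x + t * y ∈ S) :
    ENNReal.ofReal s * volume K + ENNReal.ofReal t * volume L ≤ volume S := by
  obtain ⟨k, hkK, hk⟩ := hK.exists_isGreatest hK0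
  obtain ⟨l, hlL, hl⟩ := hL.exists_isLeast hL0
  set A := (fun x => s * x + t * l) '' K
  set B := (fun y => t * y + s * k) '' L
  have hB : MeasurableSet B := (hL.image (by fun_prop)).measurableSet
  have hAB : volume (A ∩ B) = 0 := by
    refine measure_mono_null (t := {s * k + t * l}) ?_ (by simp)
    rintro _ ⟨⟨x, hx, rfl⟩, ⟨y, hy, hxy⟩⟩
    have h1 := mul_le_mul_of_nonneg_left (hk hx) hs.le
    have h2 := mul_le_mul_of_nonneg_left (hl hy) ht.le
    simp only [mem_singleton_iff] at *
    linarith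
  have hsub : A ∪ B ⊆ S := by
    rintro _ (⟨x, hx, rfl⟩ | ⟨y, hy, rfl⟩)
    · exact hS x hx l hlL
    · simpa [add_comm] using hS k hkK y hy
  rw [← volume_image_affine hs (t * l) K, ← volume_image_affine ht (s * k) L,
    ← measure_union_add_inter A hB, hAB, add_zero]
  exact measure_mono hsub

/-- One-dimensional Brunn–Minkowski inequality for weighted sums of measurable sets. -/
lemma volume_weighted_sum {s t : ℝ} (hs : 0 < s) (ht : 0 < t) {K L S : Set ℝ}
    (hK : MeasurableSet K) (hL : MeasurableSet L) (hK0 : K.Nonempty) (hL0 : L.Nonempty)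
    (hS : ∀ x ∈ K, ∀ y ∈ L, s * x + t * y ∈ S) :
    ENNReal.ofReal s * volume K + ENNReal.ofReal t * volume L ≤ volume S := by
  obtain ⟨k, hk⟩ := hK0
  obtain ⟨l, hl⟩ := hL0
  rw [hK.measure_eq_iSup_isCompact, hL.measure_eq_iSup_isCompact]
  simp only [ENNReal.mul_iSup]
  refine ENNReal.biSup_add_biSup_le' (p := fun C : Set ℝ => C ⊆ K) (q := fun C => C ⊆ L)
    ⟨∅, empty_subset _⟩ ⟨∅, empty_subset _⟩ fun C hC C' hC' => ?_
  by_cases h1 : IsCompact C <;> by_cases h2 : IsCompact C' <;> simp only [h1, h2]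
  all_goals
    simp only [iSup_pos, iSup_false, bot_eq_zero', add_zero, zero_add]
  · refine le_trans ?_ (volume_weighted_sum_compact hs ht (h1.insert k) (h2.insert l)
      (insert_nonempty _ _) (insert_nonempty _ _) ?_)
    · gcongr <;> exact subset_insert _ _
    · intro x hx y hy
      exact hS x (insert_subset hk hC hx) y (insert_subset hl hC' hy)
  · refine le_trans ?_ (volume_weighted_sum_compact hs ht (h1.insert k) (isCompact_singleton (x := l))
      (insert_nonempty _ _) (singleton_nonempty _) ?_)
    · simp only [measure_singleton, mul_zero, add_zero]
      gcongr; exact subset_insert _ _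
    · rintro x hx y rfl
      exact hS x (insert_subset hk hC hx) y hl
  · refine le_trans ?_ (volume_weighted_sum_compact hs ht (isCompact_singleton (x := k)) (h2.insert l)
      (singleton_nonempty _) (insert_nonempty _ _) ?_)
    · simp only [measure_singleton, mul_zero, zero_add]
      gcongr; exact subset_insert _ _
    · rintro x rfl y hy
      exact hS x hk y (insert_subset hl hC' hy)
  · exact zero_le

/-- Arithmetic form of the one-dimensional Prékopa–Leindler inequality for functions of
supremum one. -/
lemma lintegral_add_le_of_sup_one {s t : ℝ} (hs : 0 < s) (ht : 0 < t) {f g h : ℝ → ℝ}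
    (hf : Measurable f) (hg : Measurable g) (hh : Measurable h)
    (hf0 : ∀ x, 0 ≤ f x) (hg0 : ∀ x, 0 ≤ g x) (hh0 : ∀ x, 0 ≤ h x)
    (hf1 : ∀ x, f x ≤ 1) (hg1 : ∀ x, g x ≤ 1)
    (hfs : ∀ r < 1, ∃ x, r < f x) (hgs : ∀ r < 1, ∃ x, r < g x)
    (hfg : ∀ r, 0 < r → ∀ x y, r < f x → r < g y → r < h (s * x + t * y)) :
    ENNReal.ofReal s * (∫⁻ x, ENNReal.ofReal (f x)) +
        ENNReal.ofReal t * (∫⁻ x, ENNReal.ofReal (g x))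
      ≤ ∫⁻ x, ENNReal.ofReal (h x) := by
  rw [lintegral_eq_lintegral_meas_lt _ (ae_of_all _ hf0) hf.aemeasurable,
    lintegral_eq_lintegral_meas_lt _ (ae_of_all _ hg0) hg.aemeasurable,
    lintegral_eq_lintegral_meas_lt _ (ae_of_all _ hh0) hh.aemeasurable]
  have hm : ∀ u : ℝ → ℝ, Measurable fun r => volume {a | r < u a} := fun u =>
    Antitone.measurable fun r r' hr => measure_mono fun a ha => lt_of_le_of_lt hr ha
  rw [← lintegral_const_mul _ (hm f), ← lintegral_const_mul _ (hm g),
    ← lintegral_add_left ((hm f).const_mul _)]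
  refine setLIntegral_mono (hm h) fun r hr => ?_
  rcases lt_or_ge r 1 with h1 | h1
  · exact volume_weighted_sum hs ht (measurableSet_lt measurable_const hf)
      (measurableSet_lt measurable_const hg) (hfs r h1) (hgs r h1)
      fun x hx y hy => hfg r hr x y hx hy
  · have e1 : {a | r < f a} = ∅ := by
      ext a; simpa using (hf1 a).trans h1
    have e2 : {a | r < g a} = ∅ := by
      ext a; simpa using (hg1 a).trans h1
    simp [e1, e2]

lemma ENNReal.rpow_mul_rpow_le_add {s t : ℝ} (hs : 0 < s) (ht : 0 < t) (hst : s + t = 1)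
    (a b : ENNReal) : a ^ s * b ^ t ≤ ENNReal.ofReal s * a + ENNReal.ofReal t * b := by
  by_cases ha : a = ⊤
  · simp [ha, ENNReal.mul_top, hs]
  by_cases hb : b = ⊤
  · simp [hb, ENNReal.mul_top, ht]
  lift a to NNReal using ha
  lift b to NNReal using hb
  lift s to NNReal using hs.le
  lift t to NNReal using ht.le
  have := NNReal.geom_mean_le_arith_mean2_weighted s t a b (by exact_mod_cast hst)
  rw [← ENNReal.coe_rpow_of_nonneg _ hs.le, ← ENNReal.coe_rpow_of_nonneg _ ht.le]
  simp only [ENNReal.ofReal_coe_nnreal]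
  exact_mod_cast this

lemma prekopa_leindler_of_bounded {s t : ℝ} (hs : 0 < s) (ht : 0 < t) (hst : s + t = 1)
    {f g h : ℝ → ENNReal} (hf : Measurable f) (hg : Measurable g) (hh : Measurable h)
    (hfb : ⨆ x, f x ≠ ⊤) (hgb : ⨆ x, g x ≠ ⊤)
    (hfg : ∀ x y, f x ^ s * g y ^ t ≤ h (s * x + t * y)) :
    (∫⁻ x, f x) ^ s * (∫⁻ x, g x) ^ t ≤ ∫⁻ x, h x := by
  set a := ⨆ x, f x with ha
  set b := ⨆ x, g x with hb
  have hfa : ∀ x, f x ≤ a := le_iSup f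
  have hgb' : ∀ x, g x ≤ b := le_iSup g
  by_cases ha0 : a = 0
  · have : ∀ x, f x = 0 := fun x => le_antisymm (ha0 ▸ hfa x) (zero_le)
    simp [this, ENNReal.zero_rpow_of_pos hs]
  by_cases hb0 : b = 0
  · have : ∀ x, g x = 0 := fun x => le_antisymm (hb0 ▸ hgb' x) (zero_le)
    simp [this, ENNReal.zero_rpow_of_pos ht]
  set c := a ^ s * b ^ t with hc
  have hc0 : c ≠ 0 := by
    simp [hc, ENNReal.rpow_eq_zero_iff, ha0, hb0, hs.not_gt, ht.not_gt]
  have hct : c ≠ ⊤ := ENNReal.mul_ne_top (ENNReal.rpow_ne_top_of_nonneg hs.le hfb)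
    (ENNReal.rpow_ne_top_of_nonneg ht.le hgb)
  have hf1 : ∀ x, f x / a ≤ 1 := fun x => ENNReal.div_le_of_le_mul (by simpa using hfa x)
  have hg1 : ∀ x, g x / b ≤ 1 := fun x => ENNReal.div_le_of_le_mul (by simpa using hgb' x)
  have hh1 : ∀ x, min (h x / c) 1 ≤ 1 := fun x => min_le_right _ _
  have hft : ∀ x, f x / a ≠ ⊤ := fun x => ne_top_of_le_ne_top ENNReal.one_ne_top (hf1 x)
  have hgt : ∀ x, g x / b ≠ ⊤ := fun x => ne_top_of_le_ne_top ENNReal.one_ne_top (hg1 x)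
  have hht : ∀ x, min (h x / c) 1 ≠ ⊤ := fun x => ne_top_of_le_ne_top ENNReal.one_ne_top (hh1 x)
  have key := lintegral_add_le_of_sup_one hs ht (f := fun x => (f x / a).toReal)
    (g := fun x => (g x / b).toReal) (h := fun x => (min (h x / c) 1).toReal)
    (hf.div_const a).ennreal_toReal (hg.div_const b).ennreal_toReal
    ((hh.div_const c).min measurable_const).ennreal_toReal
    (fun _ => ENNReal.toReal_nonneg) (fun _ => ENNReal.toReal_nonneg)
    (fun _ => ENNReal.toReal_nonneg)
    (fun x => by simpa using ENNReal.toReal_mono ENNReal.one_ne_top (hf1 x))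
    (fun x => by simpa using ENNReal.toReal_mono ENNReal.one_ne_top (hg1 x)) ?_ ?_ ?_
  · simp only [ENNReal.ofReal_toReal (hft _), ENNReal.ofReal_toReal (hgt _),
      ENNReal.ofReal_toReal (hht _)] at key
    have k2 := (ENNReal.rpow_mul_rpow_le_add hs ht hst _ _).trans key
    have k3 : ∫⁻ x, min (h x / c) 1 ≤ ∫⁻ x, h x / c := lintegral_mono fun x => min_le_left _ _
    have k4 := k2.trans k3
    simp only [div_eq_mul_inv] at k4
    rw [lintegral_mul_const _ hf, lintegral_mul_const _ hg, lintegral_mul_const _ hh,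
      ENNReal.mul_rpow_of_nonneg _ _ hs.le, ENNReal.mul_rpow_of_nonneg _ _ ht.le,
      ENNReal.inv_rpow, ENNReal.inv_rpow] at k4
    have e : (∫⁻ x, f x) ^ s * (a ^ s)⁻¹ * ((∫⁻ x, g x) ^ t * (b ^ t)⁻¹)
        = (∫⁻ x, f x) ^ s * (∫⁻ x, g x) ^ t * c⁻¹ := by
      rw [hc, ENNReal.mul_inv]
      · ring
      · right; exact ENNReal.rpow_ne_top_of_nonneg ht.le hgb
      · left; exact ENNReal.rpow_ne_top_of_nonneg hs.le hfb
    rw [e] at k4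
    simpa only [mul_assoc, ENNReal.inv_mul_cancel hc0 hct, mul_one] using mul_le_mul_left k4 c
  · intro r hr
    by_contra! hcon
    have : a ≤ ENNReal.ofReal r * a := iSup_le fun x => by
      have := ENNReal.ofReal_le_ofReal (hcon x)
      rw [ENNReal.ofReal_toReal (hft x)] at this
      exact (ENNReal.div_le_iff ha0 hfb).1 this
    have h2 : ENNReal.ofReal r * a < 1 * a :=
      ENNReal.mul_lt_mul_left ha0 hfb (by simpa using hr)
    rw [one_mul] at h2
    exact absurd this h2.not_ge
  · intro r hr
    by_contra! hcon
    have : b ≤ ENNReal.ofReal r * b := iSup_le fun x => by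
      have := ENNReal.ofReal_le_ofReal (hcon x)
      rw [ENNReal.ofReal_toReal (hgt x)] at this
      exact (ENNReal.div_le_iff hb0 hgb).1 this
    have h2 : ENNReal.ofReal r * b < 1 * b :=
      ENNReal.mul_lt_mul_left hb0 hgb (by simpa using hr)
    rw [one_mul] at h2
    exact absurd this h2.not_ge
  · intro r hr x y hx hy
    rw [← ENNReal.ofReal_lt_iff_lt_toReal hr.le (hft _)] at hx
    rw [← ENNReal.ofReal_lt_iff_lt_toReal hr.le (hgt _)] at hy
    rw [← ENNReal.ofReal_lt_iff_lt_toReal hr.le (hht _)]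
    refine lt_min ?_ (hx.trans_le (hf1 x))
    have h0 : ENNReal.ofReal r ≠ 0 := by simpa using hr
    have h1 : ENNReal.ofReal r = ENNReal.ofReal r ^ s * ENNReal.ofReal r ^ t := by
      rw [← ENNReal.rpow_add _ _ h0 ENNReal.ofReal_ne_top, hst, ENNReal.rpow_one]
    have h2 : ENNReal.ofReal r < (f x / a) ^ s * (g y / b) ^ t := by
      rw [h1]
      exact ENNReal.mul_lt_mul (ENNReal.rpow_lt_rpow hx hs) (ENNReal.rpow_lt_rpow hy ht)
    refine h2.trans_le ?_
    rw [ENNReal.div_rpow_of_nonneg _ _ hs.le, ENNReal.div_rpow_of_nonneg _ _ ht.le,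
      ENNReal.le_div_iff_mul_le (Or.inl hc0) (Or.inl hct)]
    refine le_trans (le_of_eq ?_) (hfg x y)
    have e1 : a ^ s ≠ 0 := by simp [ENNReal.rpow_eq_zero_iff, ha0, hs.not_gt]
    have e2 : b ^ t ≠ 0 := by simp [ENNReal.rpow_eq_zero_iff, hb0, ht.not_gt]
    calc f x ^ s / a ^ s * (g y ^ t / b ^ t) * c
        = (f x ^ s / a ^ s * a ^ s) * (g y ^ t / b ^ t * b ^ t) := by rw [hc]; ring
      _ = _ := by
        rw [ENNReal.div_mul_cancel e1 (ENNReal.rpow_ne_top_of_nonneg hs.le hfb),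
          ENNReal.div_mul_cancel e2 (ENNReal.rpow_ne_top_of_nonneg ht.le hgb)]

/-- The one-dimensional Prékopa–Leindler inequality. -/
lemma prekopa_leindler {s t : ℝ} (hs : 0 < s) (ht : 0 < t) (hst : s + t = 1)
    {f g h : ℝ → ENNReal} (hf : Measurable f) (hg : Measurable g) (hh : Measurable h)
    (hfg : ∀ x y, f x ^ s * g y ^ t ≤ h (s * x + t * y)) :
    (∫⁻ x, f x) ^ s * (∫⁻ x, g x) ^ t ≤ ∫⁻ x, h x := by
  have hlim : ∀ u : ℝ → ENNReal, Measurable u →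
      Tendsto (fun n : ℕ => ∫⁻ x, min (u x) n) atTop (nhds (∫⁻ x, u x)) := fun u hu => by
    refine lintegral_tendsto_of_tendsto_of_monotone
      (fun n => (hu.min measurable_const).aemeasurable) ?_ ?_
    · exact ae_of_all _ fun x m n hmn => min_le_min le_rfl (by exact_mod_cast hmn)
    · refine ae_of_all _ fun x => ?_
      have := (tendsto_const_nhds (x := u x)).min ENNReal.tendsto_nat_nhds_top
      simpa using this
  have hb : ∀ (u : ℝ → ENNReal) (n : ℕ), ⨆ x, min (u x) (n : ENNReal) ≠ ⊤ := fun u n =>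
    ne_top_of_le_ne_top (ENNReal.natCast_ne_top n) (iSup_le fun x => min_le_right _ _)
  have hn : ∀ n : ℕ, (∫⁻ x, min (f x) n) ^ s * (∫⁻ x, min (g x) n) ^ t ≤ ∫⁻ x, h x := fun n => by
    refine prekopa_leindler_of_bounded hs ht hst (hf.min measurable_const)
      (hg.min measurable_const) hh (hb f n) (hb g n) fun x y => le_trans ?_ (hfg x y)
    gcongr <;> exact min_le_left _ _
  by_cases h1 : ∫⁻ x, f x = 0
  · simp [h1, ENNReal.zero_rpow_of_pos hs]
  by_cases h2 : ∫⁻ x, g x = 0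
  · simp [h2, ENNReal.zero_rpow_of_pos ht]
  refine le_of_tendsto' (ENNReal.Tendsto.mul ((ENNReal.continuous_rpow_const.tendsto _).comp
    (hlim f hf)) (Or.inl ?_) ((ENNReal.continuous_rpow_const.tendsto _).comp (hlim g hg))
    (Or.inl ?_)) hn
  · simp [ENNReal.rpow_eq_zero_iff, h1, hs.not_gt]
  · simp [ENNReal.rpow_eq_zero_iff, h2, ht.not_gt]

/-- Functional form of the Prékopa–Leindler inequality for the standard Gaussian measure
on the line. -/
lemma gaussian_prekopa_leindler {s t : ℝ} (hs : 0 < s) (ht : 0 < t) (hst : s + t = 1)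
    {f g : ℝ → ENNReal} (hf : Measurable f) (hg : Measurable g) (C : ENNReal)
    (hfg : ∀ x y, f x ^ s * g y ^ t ≤ C * ENNReal.ofReal (Real.exp (s * t * (x - y) ^ 2 / 2))) :
    (∫⁻ x, f x ∂gaussianReal 0 1) ^ s * (∫⁻ x, g x ∂gaussianReal 0 1) ^ t ≤ C := by
  set p := gaussianPDF 0 1 with hp
  have hpm : Measurable p := measurable_gaussianPDF 0 1
  have key := prekopa_leindler hs ht hst (hpm.mul hf) (hpm.mul hg) (hpm.mul_const C) ?_
  · rw [gaussianReal_of_var_ne_zero 0 one_ne_zero, lintegral_withDensity_eq_lintegral_mul _ hpm hf,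
      lintegral_withDensity_eq_lintegral_mul _ hpm hg]
    refine key.trans (le_of_eq ?_)
    rw [lintegral_mul_const _ hpm, hp, lintegral_gaussianPDF_eq_one 0 one_ne_zero, one_mul]
  · intro x y
    simp only [Pi.mul_apply]
    rw [ENNReal.mul_rpow_of_nonneg _ _ hs.le, ENNReal.mul_rpow_of_nonneg _ _ ht.le]
    have hpp : p x ^ s * p y ^ t * ENNReal.ofReal (Real.exp (s * t * (x - y) ^ 2 / 2))
        = p (s * x + t * y) := by
      simp only [hp, gaussianPDF, gaussianPDFReal]
      set c := (√(2 * Real.pi * ((1 : NNReal) : ℝ)))⁻¹ with hc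
      have hc0 : 0 < c := by positivity
      rw [ENNReal.ofReal_rpow_of_pos (by positivity), ENNReal.ofReal_rpow_of_pos (by positivity),
        ← ENNReal.ofReal_mul (by positivity), ← ENNReal.ofReal_mul (by positivity),
        Real.mul_rpow hc0.le (Real.exp_pos _).le, Real.mul_rpow hc0.le (Real.exp_pos _).le,
        ← Real.exp_mul, ← Real.exp_mul]
      congr 1
      have e1 : c ^ s * c ^ t = c := by rw [← Real.rpow_add hc0, hst, Real.rpow_one]
      calc _ = (c ^ s * c ^ t) * (Real.exp (-(x - 0) ^ 2 / (2 * ((1 : NNReal) : ℝ)) * s)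
            * Real.exp (-(y - 0) ^ 2 / (2 * ((1 : NNReal) : ℝ)) * t)
            * Real.exp (s * t * (x - y) ^ 2 / 2)) := by ring
        _ = _ := by
          rw [e1, ← Real.exp_add, ← Real.exp_add]
          congr 2
          obtain rfl : t = 1 - s := by linarith
          simp only [NNReal.coe_one]
          ring
    calc p x ^ s * f x ^ s * (p y ^ t * g y ^ t)
        = p x ^ s * p y ^ t * (f x ^ s * g y ^ t) := by ring
      _ ≤ p x ^ s * p y ^ t *
          (C * ENNReal.ofReal (Real.exp (s * t * (x - y) ^ 2 / 2))) :=
        mul_le_mul_right (hfg x y) _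
      _ = (p x ^ s * p y ^ t * ENNReal.ofReal (Real.exp (s * t * (x - y) ^ 2 / 2))) * C := by ring
      _ = _ := by rw [hpp]

lemma lintegral_pi_fin_succ (γ : Measure ℝ) [SigmaFinite γ] {n : ℕ}
    {f : (Fin (n + 1) → ℝ) → ENNReal} (hf : Measurable f) :
    ∫⁻ x, f x ∂(Measure.pi fun _ => γ) =
      ∫⁻ y, ∫⁻ z, f (Fin.cons z y) ∂γ ∂(Measure.pi fun _ : Fin n => γ) := by
  have hmp := (measurePreserving_piFinSuccAbove (fun _ : Fin (n + 1) => γ) 0).symm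
  rw [← hmp.lintegral_comp hf, lintegral_prod_symm']
  · simp [MeasurableEquiv.piFinSuccAbove, Fin.insertNthEquiv]
  · exact hf.comp hmp.measurable

lemma measurable_finCons {n : ℕ} :
    Measurable fun p : ℝ × (Fin n → ℝ) => (Fin.cons p.1 p.2 : Fin (n + 1) → ℝ) := by
  refine measurable_pi_lambda _ fun i => ?_
  refine Fin.cases ?_ (fun j => ?_) i
  · simpa using measurable_fst
  · simp only [Fin.cons_succ]
    fun_prop

/-- Functional form of the Prékopa–Leindler inequality for the standard Gaussian measure
on `ℝⁿ`. -/
lemma gaussian_pi_prekopa_leindler {s t : ℝ} (hs : 0 < s) (ht : 0 < t) (hst : s + t = 1)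
    (n : ℕ) : ∀ {f g : (Fin n → ℝ) → ENNReal}, Measurable f → Measurable g → ∀ C : ENNReal,
    (∀ x y, f x ^ s * g y ^ t ≤
      C * ENNReal.ofReal (Real.exp (s * t * (∑ i, (x i - y i) ^ 2) / 2))) →
    (∫⁻ x, f x ∂(Measure.pi fun _ => gaussianReal 0 1)) ^ s *
      (∫⁻ x, g x ∂(Measure.pi fun _ => gaussianReal 0 1)) ^ t ≤ C := by
  induction n with
  | zero =>
    intro f g hf hg C hfg
    rw [Measure.pi_of_empty (fun _ : Fin 0 => gaussianReal 0 1) 0, lintegral_dirac, lintegral_dirac]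
    simpa using hfg 0 0
  | succ n ih =>
    intro f g hf hg C hfg
    rw [lintegral_pi_fin_succ _ hf, lintegral_pi_fin_succ _ hg]
    refine ih (hf.comp measurable_finCons).lintegral_prod_left'
      (hg.comp measurable_finCons).lintegral_prod_left' C fun x y => ?_
    refine gaussian_prekopa_leindler hs ht hst
      (hf.comp (measurable_finCons.comp measurable_prodMk_right))
      (hg.comp (measurable_finCons.comp measurable_prodMk_right)) _ fun z w => ?_
    refine (hfg _ _).trans (le_of_eq ?_)
    rw [mul_assoc C, ← ENNReal.ofReal_mul (Real.exp_pos _).le, ← Real.exp_add, Fin.sum_univ_succ]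
    simp only [Function.comp_apply, Fin.cons_zero, Fin.cons_succ]
    congr 3
    ring

/-- Exponential moment bound for a square-Lipschitz function of a standard Gaussian vector,
with a free splitting parameter. -/
lemma gaussian_pi_exp_moment_aux {n : ℕ} {F : (Fin n → ℝ) → ℝ} (hF : Measurable F)
    {c : ℝ} (hc : 0 ≤ c) (hLip : ∀ x y, (F x - F y) ^ 2 ≤ c * ∑ i, (x i - y i) ^ 2)
    (hint : Integrable F (Measure.pi fun _ => gaussianReal 0 1)) {l : ℝ} (hl : 0 < l)
    {t : ℝ} (ht : 0 < t) (ht1 : t < 1) :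
    ∫⁻ x, ENNReal.ofReal (Real.exp (l * F x)) ∂(Measure.pi fun _ => gaussianReal 0 1) ≤
      ENNReal.ofReal (Real.exp (l * (∫ x, F x ∂(Measure.pi fun _ => gaussianReal 0 1))
        + l ^ 2 * c / (2 * t))) := by
  set γ : Measure (Fin n → ℝ) := Measure.pi fun _ => gaussianReal 0 1
  set s := 1 - t with hs
  have hs0 : 0 < s := by linarith
  set m := ∫ x, F x ∂γ with hm
  have key := gaussian_pi_prekopa_leindler hs0 ht (by simp [hs]) n
    (f := fun x => ENNReal.ofReal (Real.exp (l * F x)))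
    (g := fun x => ENNReal.ofReal (Real.exp (-(s / t * l) * F x)))
    (by fun_prop) (by fun_prop) (ENNReal.ofReal (Real.exp (s * (l ^ 2 * c / (2 * t))))) ?_
  · have hJ : ENNReal.ofReal (Real.exp (-(s / t * l) * m)) ≤
        ∫⁻ x, ENNReal.ofReal (Real.exp (-(s / t * l) * F x)) ∂γ := by
      by_cases hfin : ∫⁻ x, ENNReal.ofReal (Real.exp (-(s / t * l) * F x)) ∂γ = ⊤
      · exact hfin ▸ le_top
      have hexp : Integrable (fun x => Real.exp (-(s / t * l) * F x)) γ :=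
        (lintegral_ofReal_ne_top_iff_integrable (by fun_prop)
          (ae_of_all _ fun x => (Real.exp_pos _).le)).1 hfin
      rw [← ofReal_integral_eq_lintegral_ofReal hexp (ae_of_all _ fun x => (Real.exp_pos _).le)]
      refine ENNReal.ofReal_le_ofReal ?_
      have := ConvexOn.map_integral_le (μ := γ) convexOn_exp Real.continuous_exp.continuousOn
        isClosed_univ (f := fun x => -(s / t * l) * F x) (by simp) (hint.const_mul _) hexp
      rwa [integral_const_mul] at this
    have h1 : (∫⁻ x, ENNReal.ofReal (Real.exp (l * F x)) ∂γ) ^ s *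
        ENNReal.ofReal (Real.exp (-(s * l * m))) ≤
        ENNReal.ofReal (Real.exp (s * (l ^ 2 * c / (2 * t)))) := by
      refine le_trans ?_ key
      gcongr
      refine le_trans (le_of_eq ?_) (ENNReal.rpow_le_rpow hJ ht.le)
      rw [ENNReal.ofReal_rpow_of_pos (Real.exp_pos _), ← Real.exp_mul]
      congr 2
      field_simp
    have h2 : (∫⁻ x, ENNReal.ofReal (Real.exp (l * F x)) ∂γ) ^ s ≤
        ENNReal.ofReal (Real.exp (l * m + l ^ 2 * c / (2 * t))) ^ s := by
      have h3 := mul_le_mul_left h1 (ENNReal.ofReal (Real.exp (s * l * m)))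
      rw [mul_assoc, ← ENNReal.ofReal_mul (Real.exp_pos _).le, ← Real.exp_add, neg_add_cancel,
        Real.exp_zero, ENNReal.ofReal_one, mul_one, ← ENNReal.ofReal_mul (Real.exp_pos _).le,
        ← Real.exp_add] at h3
      refine h3.trans (le_of_eq ?_)
      rw [ENNReal.ofReal_rpow_of_pos (Real.exp_pos _), ← Real.exp_mul]
      congr 2
      ring
    exact (ENNReal.rpow_le_rpow_iff hs0).1 h2
  · intro x y
    rw [ENNReal.ofReal_rpow_of_pos (Real.exp_pos _), ENNReal.ofReal_rpow_of_pos (Real.exp_pos _),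
      ← Real.exp_mul, ← Real.exp_mul, ← ENNReal.ofReal_mul (Real.exp_pos _).le,
      ← ENNReal.ofReal_mul (Real.exp_pos _).le, ← Real.exp_add, ← Real.exp_add]
    refine ENNReal.ofReal_le_ofReal (Real.exp_le_exp.2 ?_)
    have hL := hLip x y
    set d := ∑ i, (x i - y i) ^ 2
    have e : l * F x * s + -(s / t * l) * F y * t = s * (l * (F x - F y)) := by
      field_simp
      ring
    rw [e]
    have e2 : s * (l ^ 2 * c / (2 * t)) + s * t * d / 2 = s * (l ^ 2 * c / (2 * t) + t * d / 2) := by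
      ring
    rw [e2]
    refine mul_le_mul_of_nonneg_left ?_ hs0.le
    have hd : 0 ≤ d := Finset.sum_nonneg fun i _ => sq_nonneg _
    rw [div_add_div _ _ (by positivity) two_ne_zero, le_div_iff₀ (by positivity)]
    rcases hc.eq_or_lt with rfl | hc
    · have : F x - F y = 0 := by nlinarith
      rw [this]
      simp only [mul_zero, zero_mul, zero_add]
      positivity
    · refine le_of_mul_le_mul_left ?_ hc
      nlinarith [sq_nonneg (l * c - t * (F x - F y)), mul_le_mul_of_nonneg_left hL (sq_nonneg t)]

/-- Gaussian concentration: a square-Lipschitz function of a standard Gaussian vector has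
sub-Gaussian exponential moments with the optimal constant. -/
lemma gaussian_pi_exp_moment {n : ℕ} {F : (Fin n → ℝ) → ℝ} (hF : Measurable F)
    {c : ℝ} (hc : 0 ≤ c) (hLip : ∀ x y, (F x - F y) ^ 2 ≤ c * ∑ i, (x i - y i) ^ 2)
    (hint : Integrable F (Measure.pi fun _ => gaussianReal 0 1)) {l : ℝ} (hl : 0 < l) :
    ∫⁻ x, ENNReal.ofReal (Real.exp (l * F x)) ∂(Measure.pi fun _ => gaussianReal 0 1) ≤
      ENNReal.ofReal (Real.exp (l * (∫ x, F x ∂(Measure.pi fun _ => gaussianReal 0 1))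
        + l ^ 2 * c / 2)) := by
  set m := ∫ x, F x ∂(Measure.pi fun _ => gaussianReal 0 1)
  have hcont : ContinuousAt (fun t : ℝ =>
      ENNReal.ofReal (Real.exp (l * m + l ^ 2 * c / (2 * t)))) 1 := by
    refine ENNReal.continuous_ofReal.continuousAt.comp (Real.continuous_exp.continuousAt.comp ?_)
    exact continuousAt_const.add (continuousAt_const.div (by fun_prop) (by norm_num))
  have hlim : Tendsto (fun t : ℝ =>
      ENNReal.ofReal (Real.exp (l * m + l ^ 2 * c / (2 * t)))) (nhdsWithin 1 (Iio 1))
      (nhds (ENNReal.ofReal (Real.exp (l * m + l ^ 2 * c / 2)))) := by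
    simpa using hcont.tendsto.mono_left nhdsWithin_le_nhds
  refine ge_of_tendsto hlim ?_
  filter_upwards [Ioo_mem_nhdsLT (zero_lt_one' ℝ)] with t ht
  exact gaussian_pi_exp_moment_aux hF hc hLip hint hl ht.1 ht.2

/-- Gaussian concentration inequality for the upper tail. -/
lemma gaussian_pi_tail {n : ℕ} {F : (Fin n → ℝ) → ℝ} (hF : Measurable F)
    {c : ℝ} (hc : 0 < c) (hLip : ∀ x y, (F x - F y) ^ 2 ≤ c * ∑ i, (x i - y i) ^ 2)
    (hint : Integrable F (Measure.pi fun _ => gaussianReal 0 1)) {v : ℝ}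
    (hv : ∫ x, F x ∂(Measure.pi fun _ => gaussianReal 0 1) < v) :
    (Measure.pi fun _ => gaussianReal 0 1) {x | v < F x} ≤
      ENNReal.ofReal (Real.exp
        (-(v - ∫ x, F x ∂(Measure.pi fun _ => gaussianReal 0 1)) ^ 2 / (2 * c))) := by
  set γ : Measure (Fin n → ℝ) := Measure.pi fun _ => gaussianReal 0 1
  set m := ∫ x, F x ∂γ
  set l := (v - m) / c with hl
  have hl0 : 0 < l := div_pos (by linarith) hc
  have h1 := mul_meas_ge_le_lintegral (μ := γ)
    (f := fun x => ENNReal.ofReal (Real.exp (l * F x))) (by fun_prop)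
    (ENNReal.ofReal (Real.exp (l * v)))
  have h2 := h1.trans (gaussian_pi_exp_moment hF hc.le hLip hint hl0)
  have h3 : γ {x | v < F x} ≤
      γ {x | ENNReal.ofReal (Real.exp (l * v)) ≤ ENNReal.ofReal (Real.exp (l * F x))} := by
    refine measure_mono fun x hx => ?_
    exact ENNReal.ofReal_le_ofReal (Real.exp_le_exp.2 (mul_le_mul_of_nonneg_left (le_of_lt hx) hl0.le))
  have h4 := mul_le_mul_right ((mul_le_mul_right h3 _).trans h2)
    (ENNReal.ofReal (Real.exp (-(l * v))))
  rw [← mul_assoc, ← ENNReal.ofReal_mul (Real.exp_pos _).le, ← Real.exp_add, neg_add_cancel,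
    Real.exp_zero, ENNReal.ofReal_one, one_mul, ← ENNReal.ofReal_mul (Real.exp_pos _).le,
    ← Real.exp_add] at h4
  refine h4.trans (le_of_eq ?_)
  congr 2
  rw [hl]
  field_simp
  ring

section GaussianVector

variable {Ω : Type*} [MeasurableSpace Ω] {P : Measure Ω}

lemma aemeasurable_of_map_eq_gaussianReal {Z : Ω → ℝ} {v : NNReal}
    (h : P.map Z = gaussianReal 0 v) : AEMeasurable Z P := by
  by_contra hc
  rw [Measure.map_of_not_aemeasurable hc] at h
  exact IsProbabilityMeasure.ne_zero (gaussianReal 0 v) h.symm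

lemma memLp_of_map_eq_gaussianReal {Z : Ω → ℝ} {v : NNReal}
    (h : P.map Z = gaussianReal 0 v) (p : NNReal) : MemLp Z p P := by
  have := memLp_id_gaussianReal (μ := 0) (v := v) p
  rw [← h, memLp_map_measure_iff aestronglyMeasurable_id
    (aemeasurable_of_map_eq_gaussianReal h)] at this
  exact this

lemma integral_of_map_eq_gaussianReal {Z : Ω → ℝ} {v : NNReal}
    (h : P.map Z = gaussianReal 0 v) : ∫ ω, Z ω ∂P = 0 := by
  have := integral_id_gaussianReal (μ := 0) (v := v)
  rwa [← h, integral_map (aemeasurable_of_map_eq_gaussianReal h) (by fun_prop)] at this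

lemma integral_sq_of_map_eq_gaussianReal {Z : Ω → ℝ} {v : NNReal}
    (h : P.map Z = gaussianReal 0 v) : ∫ ω, Z ω ^ 2 ∂P = v := by
  have := variance_id_gaussianReal (μ := 0) (v := v)
  rw [variance_of_integral_eq_zero aemeasurable_id (by simp), ← h,
    integral_map (aemeasurable_of_map_eq_gaussianReal h) (by fun_prop)] at this
  simpa using this

variable {n : ℕ} {Y : Fin n → Ω → ℝ}

lemma exists_map_eq_gaussianReal_of_combo
    (hY : ∀ c : Fin n → ℝ, ∃ v, P.map (fun ω => ∑ i, c i * Y i ω) = gaussianReal 0 v) (i : Fin n) :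
    ∃ v, P.map (Y i) = gaussianReal 0 v := by
  obtain ⟨v, hv⟩ := hY (Pi.single i 1)
  refine ⟨v, ?_⟩
  simpa [Pi.single_apply] using hv

lemma aemeasurable_toLp_vector (hYm : ∀ i, AEMeasurable (Y i) P) :
    AEMeasurable (fun ω => (WithLp.toLp 2 fun i => Y i ω : EuclideanSpace ℝ (Fin n))) P :=
  (WithLp.measurable_toLp 2 _).comp_aemeasurable (aemeasurable_pi_lambda _ hYm)

lemma charFun_gaussian_vector
    (hY : ∀ c : Fin n → ℝ, ∃ v, P.map (fun ω => ∑ i, c i * Y i ω) = gaussianReal 0 v)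
    (c : EuclideanSpace ℝ (Fin n)) :
    charFun (P.map fun ω => WithLp.toLp 2 fun i => Y i ω) c =
      Complex.exp (-((∫ ω, (∑ i, c i * Y i ω) ^ 2 ∂P : ℝ) : ℂ) / 2) := by
  have hYm : ∀ i, AEMeasurable (Y i) P := fun i =>
    aemeasurable_of_map_eq_gaussianReal (exists_map_eq_gaussianReal_of_combo hY i).choose_spec
  obtain ⟨v, hv⟩ := hY c
  rw [integral_sq_of_map_eq_gaussianReal hv, charFun_apply, integral_map (aemeasurable_toLp_vector hYm) (by fun_prop)]
  have h1 := charFun_gaussianReal (μ := 0) (v := v) 1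
  rw [← hv, charFun_apply_real, integral_map (aemeasurable_of_map_eq_gaussianReal hv)
    (by fun_prop)] at h1
  simpa [PiLp.inner_apply, neg_div] using h1

open scoped MatrixOrder in
/-- A centered Gaussian vector is a linear image of a standard Gaussian vector. -/
lemma exists_matrix_map_eq_gaussian_vector [IsProbabilityMeasure P]
    (hY : ∀ c : Fin n → ℝ, ∃ v, P.map (fun ω => ∑ i, c i * Y i ω) = gaussianReal 0 v) :
    ∃ A : Matrix (Fin n) (Fin n) ℝ,
      P.map (fun ω i => Y i ω) = (Measure.pi fun _ => gaussianReal 0 1).map A.mulVec ∧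
      ∀ i, ∑ j, A i j ^ 2 = ∫ ω, Y i ω ^ 2 ∂P := by
  have hex := exists_map_eq_gaussianReal_of_combo hY
  have hYm : ∀ i, AEMeasurable (Y i) P := fun i =>
    aemeasurable_of_map_eq_gaussianReal (hex i).choose_spec
  have hYL : ∀ i, MemLp (Y i) 2 P := fun i => by
    exact_mod_cast memLp_of_map_eq_gaussianReal (hex i).choose_spec 2
  have hYY : ∀ i j, Integrable (fun ω => Y i ω * Y j ω) P := fun i j =>
    (hYL i).integrable_mul (hYL j)
  set S : Matrix (Fin n) (Fin n) ℝ := Matrix.of fun i j => ∫ ω, Y i ω * Y j ω ∂P with hS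
  have hquad : ∀ c : Fin n → ℝ, dotProduct c (S.mulVec c) = ∫ ω, (∑ i, c i * Y i ω) ^ 2 ∂P := by
    intro c
    simp only [dotProduct, Matrix.mulVec, hS, Matrix.of_apply, sq, Finset.sum_mul_sum]
    rw [integral_finsetSum]
    · refine Finset.sum_congr rfl fun i _ => ?_
      rw [integral_finsetSum, Finset.mul_sum]
      · refine Finset.sum_congr rfl fun j _ => ?_
        rw [← integral_mul_const, ← integral_const_mul]
        congr 1; ext ω; ring
      · intro j _
        exact ((hYY i j).const_mul (c i * c j)).congr (ae_of_all _ fun ω => by ring)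
    · intro i _
      refine integrable_finsetSum _ fun j _ => ?_
      exact ((hYY i j).const_mul (c i * c j)).congr (ae_of_all _ fun ω => by ring)
  have hSpos : S.PosSemidef := by
    refine Matrix.PosSemidef.of_dotProduct_mulVec_nonneg ?_ fun c => ?_
    · ext i j
      simp [hS, mul_comm]
    · simp only [star_trivial]
      rw [hquad]
      exact integral_nonneg fun ω => sq_nonneg _
  have hlaw : P.map (fun ω => (WithLp.toLp 2 fun i => Y i ω : EuclideanSpace ℝ (Fin n))) =
      multivariateGaussian 0 S := by
    have := Measure.isProbabilityMeasure_map (aemeasurable_toLp_vector hYm)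
    refine Measure.ext_of_charFun (funext fun c => ?_)
    rw [charFun_gaussian_vector hY, charFun_multivariateGaussian hSpos, hquad]
    simp [neg_div]
  set A := CFC.sqrt S with hA
  have hAA : A * A = S := CFC.sqrt_mul_sqrt_self S hSpos.nonneg
  have hAt : A.transpose = A := by
    have := (CFC.sqrt_nonneg S).isSelfAdjoint
    simpa [IsSelfAdjoint, Matrix.star_eq_conjTranspose,
      Matrix.conjTranspose_eq_transpose_of_trivial] using this
  refine ⟨A, ?_, fun i => ?_⟩
  · have h1 := congrArg (Measure.map (WithLp.ofLp (p := 2) (V := Fin n → ℝ))) hlaw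
    rw [AEMeasurable.map_map_of_aemeasurable (by fun_prop) (aemeasurable_toLp_vector hYm),
      multivariateGaussian, ← map_pi_eq_stdGaussian, Measure.map_map (by fun_prop) (by fun_prop),
      Measure.map_map (by fun_prop) (by fun_prop)] at h1
    have e : A.mulVec = (WithLp.ofLp ∘ fun x => 0 + (Matrix.toEuclideanCLM (𝕜 := ℝ) A) x) ∘
        WithLp.toLp 2 := by
      ext x i
      simp
    rw [e]
    exact h1
  · have h1 : (A * A) i i = S i i := by rw [hAA]
    rw [Matrix.mul_apply] at h1
    simp only [hS, Matrix.of_apply, ← sq] at h1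
    rw [← h1]
    refine Finset.sum_congr rfl fun j _ => ?_
    rw [sq, ← congrFun (congrFun hAt j) i, Matrix.transpose_apply]

lemma map_neg_eq_of_gaussian_vector [IsProbabilityMeasure P]
    (hY : ∀ c : Fin n → ℝ, ∃ v, P.map (fun ω => ∑ i, c i * Y i ω) = gaussianReal 0 v) :
    P.map (fun ω i => -Y i ω) = P.map (fun ω i => Y i ω) := by
  have hYm : ∀ i, AEMeasurable (Y i) P := fun i =>
    aemeasurable_of_map_eq_gaussianReal (exists_map_eq_gaussianReal_of_combo hY i).choose_spec
  have hm := aemeasurable_toLp_vector hYm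
  have hm' := aemeasurable_toLp_vector (Y := fun i ω => -Y i ω) fun i => (hYm i).neg
  have hY' : ∀ c : Fin n → ℝ, ∃ v, P.map (fun ω => ∑ i, c i * -Y i ω) = gaussianReal 0 v :=
    fun c => by simpa using hY (-c)
  have hlaw : P.map (fun ω => (WithLp.toLp 2 fun i => -Y i ω : EuclideanSpace ℝ (Fin n))) =
      P.map (fun ω => (WithLp.toLp 2 fun i => Y i ω : EuclideanSpace ℝ (Fin n))) := by
    have := Measure.isProbabilityMeasure_map hm
    have := Measure.isProbabilityMeasure_map hm'
    refine Measure.ext_of_charFun (funext fun c => ?_)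
    rw [charFun_gaussian_vector hY, charFun_gaussian_vector (Y := fun i ω => -Y i ω) hY']
    simp
  have h1 := congrArg (Measure.map (WithLp.ofLp (p := 2) (V := Fin n → ℝ))) hlaw
  rwa [AEMeasurable.map_map_of_aemeasurable (by fun_prop) hm,
    AEMeasurable.map_map_of_aemeasurable (by fun_prop) hm'] at h1

/-- Borell–TIS inequality for the maximum of a centered Gaussian vector. -/
lemma gaussian_vector_max_tail [IsProbabilityMeasure P] [Nonempty (Fin n)]
    (hY : ∀ c : Fin n → ℝ, ∃ v, P.map (fun ω => ∑ i, c i * Y i ω) = gaussianReal 0 v)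
    {c : ℝ} (hc : 0 < c) (hvar : ∀ i, ∫ ω, Y i ω ^ 2 ∂P ≤ c) {v : ℝ}
    (hv : ∫ ω, ⨆ i, Y i ω ∂P < v) :
    P {ω | v < ⨆ i, Y i ω} ≤
      ENNReal.ofReal (Real.exp (-(v - ∫ ω, ⨆ i, Y i ω ∂P) ^ 2 / (2 * c))) := by
  have hex := exists_map_eq_gaussianReal_of_combo hY
  have hYm : ∀ i, AEMeasurable (Y i) P := fun i =>
    aemeasurable_of_map_eq_gaussianReal (hex i).choose_spec
  have hYi : ∀ i, Integrable (Y i) P := fun i =>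
    memLp_one_iff_integrable.1 (by
      exact_mod_cast memLp_of_map_eq_gaussianReal (hex i).choose_spec 1)
  have hYv : AEMeasurable (fun ω i => Y i ω) P := aemeasurable_pi_lambda _ hYm
  obtain ⟨A, hA, hAv⟩ := exists_matrix_map_eq_gaussian_vector hY
  set G : (Fin n → ℝ) → ℝ := fun x => ⨆ i, x i with hG
  have hGm : Measurable G := Measurable.iSup fun i => measurable_pi_apply i
  have hAm : Measurable A.mulVec := by
    refine measurable_pi_lambda _ fun i => ?_
    simp only [Matrix.mulVec, dotProduct]
    fun_prop
  have hbdd : ∀ x : Fin n → ℝ, BddAbove (range x) := fun x => Set.finite_range x |>.bddAbove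
  have hGint : Integrable (fun ω => G fun i => Y i ω) P := by
    refine Integrable.mono' (g := fun ω => ∑ i, |Y i ω|)
      (integrable_finsetSum _ fun i _ => (hYi i).abs)
      (hGm.comp_aemeasurable hYv).aestronglyMeasurable (ae_of_all _ fun ω => ?_)
    rw [Real.norm_eq_abs, abs_le]
    have hle : ∀ i, |Y i ω| ≤ ∑ i, |Y i ω| := fun i =>
      Finset.single_le_sum (f := fun i => |Y i ω|) (fun i _ => abs_nonneg _) (Finset.mem_univ i)
    constructor
    · obtain ⟨i⟩ := (inferInstance : Nonempty (Fin n))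
      exact (neg_le_neg (hle i)).trans ((neg_abs_le _).trans (le_ciSup (hbdd fun i => Y i ω) i))
    · exact ciSup_le fun i => (le_abs_self _).trans (hle i)
  have hFint : Integrable (fun x => G (A.mulVec x)) (Measure.pi fun _ => gaussianReal 0 1) := by
    rw [← Function.comp_def G A.mulVec, ← integrable_map_measure hGm.aestronglyMeasurable
      hAm.aemeasurable, ← hA, integrable_map_measure hGm.aestronglyMeasurable hYv]
    exact hGint
  have hmean : ∫ x, G (A.mulVec x) ∂(Measure.pi fun _ => gaussianReal 0 1) =
      ∫ ω, ⨆ i, Y i ω ∂P := by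
    rw [← integral_map hAm.aemeasurable hGm.aestronglyMeasurable, ← hA,
      integral_map hYv hGm.aestronglyMeasurable]
  have hone : ∀ x y, G (A.mulVec x) - G (A.mulVec y) ≤ √(c * ∑ i, (x i - y i) ^ 2) := by
    intro x y
    rw [sub_le_iff_le_add]
    refine ciSup_le fun i => ?_
    have h1 := le_ciSup (hbdd (A.mulVec y)) i
    have h2 : A.mulVec x i - A.mulVec y i ≤ √(c * ∑ i, (x i - y i) ^ 2) := by
      refine Real.le_sqrt_of_sq_le ?_
      have e : A.mulVec x i - A.mulVec y i = ∑ j, A i j * (x j - y j) := by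
        simp only [Matrix.mulVec, dotProduct, ← Finset.sum_sub_distrib, mul_sub]
      rw [e]
      refine (Finset.sum_mul_sq_le_sq_mul_sq _ _ _).trans ?_
      gcongr
      exact (hAv i).trans_le (hvar i)
    simp only [hG]
    linarith
  have hLip : ∀ x y, (G (A.mulVec x) - G (A.mulVec y)) ^ 2 ≤ c * ∑ i, (x i - y i) ^ 2 := by
    intro x y
    have h0 : 0 ≤ c * ∑ i, (x i - y i) ^ 2 := by positivity
    rw [← Real.sq_sqrt h0]
    refine sq_le_sq' ?_ (hone x y)
    have := hone y x
    simp only [sub_sq_comm (y _)] at this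
    linarith
  have key := gaussian_pi_tail (hGm.comp hAm) hc hLip hFint (v := v) (hmean.trans_lt hv)
  rw [← hmean]
  refine le_trans (le_of_eq ?_) key
  have hset : MeasurableSet {x | v < G x} := measurableSet_lt measurable_const hGm
  have h1 : P {ω | v < ⨆ i, Y i ω} = P.map (fun ω i => Y i ω) {x | v < G x} :=
    (Measure.map_apply_of_aemeasurable hYv hset).symm
  rw [h1, hA, Measure.map_apply hAm hset]
  rfl

end GaussianVector

section CadlagPath

theorem IsCadlagPath.exists_abs_le {f : ℝ → ℝ} (hf : IsCadlagPath f) :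
    ∃ C, ∀ s ∈ Set.Icc (0 : ℝ) 1, |f s| ≤ C := by
  refine isCompact_Icc.induction_on (p := fun S => ∃ C, ∀ s ∈ S, |f s| ≤ C) ⟨0, by simp⟩
    (fun S T hST ⟨C, hC⟩ => ⟨C, fun s hs => hC s (hST hs)⟩)
    (fun S T ⟨C, hC⟩ ⟨C', hC'⟩ => ⟨max C C', fun s hs => ?_⟩) fun x hx => ?_
  · rcases hs with hs | hs
    · exact le_max_of_le_left (hC s hs)
    · exact le_max_of_le_right (hC' s hs)
  · have hleft : ∃ C, ∀ᶠ y in nhdsWithin x (Set.Iio x ∩ Set.Icc 0 1), |f y| ≤ C := by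
      rcases hx.1.eq_or_lt with rfl | h0
      · refine ⟨0, ?_⟩
        filter_upwards [self_mem_nhdsWithin] with y hy
        exact absurd hy.1 (not_lt.2 hy.2.1)
      · obtain ⟨l, hl⟩ := hf.2 x ⟨h0, hx.2⟩
        obtain ⟨C, hC⟩ := hl.abs.isBoundedUnder_le
        exact ⟨C, (Filter.eventually_map.1 hC).filter_mono
          (nhdsWithin_mono _ Set.inter_subset_left)⟩
    have hright : ∃ C, ∀ᶠ y in nhdsWithin x (Set.Ici x ∩ Set.Icc 0 1), |f y| ≤ C := by
      rcases hx.2.eq_or_lt with rfl | h1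
      · refine ⟨|f 1|, ?_⟩
        filter_upwards [self_mem_nhdsWithin] with y hy
        rw [le_antisymm hy.2.2 hy.1]
      · obtain ⟨C, hC⟩ := (hf.1 x ⟨hx.1, h1⟩).tendsto.abs.isBoundedUnder_le
        exact ⟨C, (Filter.eventually_map.1 hC).filter_mono
          (nhdsWithin_mono _ Set.inter_subset_left)⟩
    obtain ⟨C, hC⟩ := hleft
    obtain ⟨C', hC'⟩ := hright
    refine ⟨{y | |f y| ≤ max C C'}, ?_, C ⊔ C', fun s hs => hs⟩
    have hsplit : Set.Icc (0 : ℝ) 1 =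
        Set.Iio x ∩ Set.Icc 0 1 ∪ Set.Ici x ∩ Set.Icc 0 1 := by
      rw [← Set.union_inter_distrib_right, Set.Iio_union_Ici, Set.univ_inter]
    rw [hsplit, nhdsWithin_union]
    exact ⟨hC.mono fun y hy => le_max_of_le_left hy, hC'.mono fun y hy => le_max_of_le_right hy⟩

theorem IsCadlagPath.neg {f : ℝ → ℝ} (hf : IsCadlagPath f) : IsCadlagPath fun s => -f s :=
  ⟨fun t ht => (hf.1 t ht).neg, fun t ht => let ⟨l, hl⟩ := hf.2 t ht; ⟨-l, hl.neg⟩⟩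

theorem IsCadlagPath.bddAbove_range {f : ℝ → ℝ} (hf : IsCadlagPath f) {t : ℝ} (ht : t ≤ 1) :
    BddAbove (Set.range fun s : Set.Icc (0 : ℝ) t => f s.1) := by
  obtain ⟨C, hC⟩ := hf.exists_abs_le
  refine ⟨C, ?_⟩
  rintro _ ⟨s, rfl⟩
  exact (le_abs_self _).trans (hC s.1 ⟨s.2.1, s.2.2.trans ht⟩)

theorem neg_iInf_Icc_eq_iSup_neg (f : ℝ → ℝ) (t : ℝ) :
    -(⨅ s : Set.Icc (0 : ℝ) t, f s.1) = ⨆ s : Set.Icc (0 : ℝ) t, -f s.1 := by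
  rw [iInf, Real.sInf_def, neg_neg, iSup]
  congr 1
  ext y
  simp [neg_eq_iff_eq_neg, eq_neg_iff_add_eq_zero, add_comm]

/-- A sequence in `[0, t]` that contains `t` and meets every open subinterval. -/
theorem exists_seq_dense_Icc {t : ℝ} (ht : 0 < t) :
    ∃ q : ℕ → ℝ, q 0 = t ∧ (∀ n, q n ∈ Set.Icc 0 t) ∧
      ∀ s s', 0 ≤ s → s < s' → s' ≤ t → ∃ n, q n ∈ Set.Ioo s s' := by
  obtain ⟨d, hd⟩ := TopologicalSpace.exists_dense_seq ℝ
  refine ⟨fun n => match n with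
    | 0 => t
    | n + 1 => Set.projIcc 0 t ht.le (d n), rfl, fun n => ?_, fun s s' hs hss hst => ?_⟩
  · match n with
    | 0 => exact ⟨ht.le, le_rfl⟩
    | n + 1 => exact Subtype.prop _
  · obtain ⟨n, hn⟩ := hd.exists_mem_open isOpen_Ioo (Set.nonempty_Ioo.2 hss)
    refine ⟨n + 1, ?_⟩
    show (Set.projIcc 0 t ht.le (d n) : ℝ) ∈ Set.Ioo s s'
    rwa [Set.projIcc_of_mem ht.le ⟨hs.trans hn.1.le, hn.2.le.trans hst⟩]

theorem IsCadlagPath.iSup_eq_iSup_seq {f : ℝ → ℝ} (hf : IsCadlagPath f) {t : ℝ} (ht : t ≤ 1)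
    {q : ℕ → ℝ} (hq0 : q 0 = t) (hq : ∀ n, q n ∈ Set.Icc 0 t)
    (hqd : ∀ s s', 0 ≤ s → s < s' → s' ≤ t → ∃ n, q n ∈ Set.Ioo s s') :
    ⨆ s : Set.Icc (0 : ℝ) t, f s.1 = ⨆ n, f (q n) := by
  have hbdd := hf.bddAbove_range ht
  have hbddq : BddAbove (Set.range fun n => f (q n)) := by
    refine hbdd.mono ?_
    rintro _ ⟨n, rfl⟩
    exact ⟨⟨q n, hq n⟩, rfl⟩
  have : Nonempty (Set.Icc (0 : ℝ) t) := ⟨⟨q 0, hq 0⟩⟩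
  refine le_antisymm (ciSup_le fun ⟨s, hs⟩ => ?_)
    (ciSup_le fun n => le_ciSup hbdd ⟨q n, hq n⟩)
  rcases hs.2.eq_or_lt with rfl | hst
  · exact hq0 ▸ le_ciSup hbddq 0
  refine le_of_forall_lt fun y hy => ?_
  have hev := (hf.1 s ⟨hs.1, hst.trans_le ht⟩).tendsto.eventually_const_lt hy
  have hev' : ∀ᶠ z in nhdsWithin s (Set.Ioi s), y < f z :=
    hev.filter_mono (nhdsWithin_mono _ Set.Ioi_subset_Ici_self)
  obtain ⟨s', hs', hsub⟩ := (mem_nhdsGT_iff_exists_Ioo_subset' hst).1 hev'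
  obtain ⟨n, hn⟩ := hqd s (min s' t) hs.1 (lt_min hs' hst) (min_le_right _ _)
  have hlt : y < f (q n) := hsub ⟨hn.1, hn.2.trans_le (min_le_left _ _)⟩
  exact hlt.trans_le (le_ciSup hbddq n)

end CadlagPath

section GaussianSequence

variable {Ω : Type*} {Z : ℕ → Ω → ℝ}

theorem bddAbove_range_fin (n : ℕ) (ω : Ω) :
    BddAbove (Set.range fun i : Fin n => Z i ω) :=
  Set.finite_range _ |>.bddAbove

theorem setOf_lt_iSup_nat_eq_iUnion
    (hb : ∀ ω, BddAbove (Set.range fun n => Z n ω)) (u : ℝ) :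
    {ω | u < ⨆ n, Z n ω} = ⋃ n : ℕ, {ω | u < ⨆ i : Fin (n + 1), Z i ω} := by
  ext ω
  simp only [Set.mem_ofPred_eq, Set.mem_iUnion]
  constructor
  · intro h
    obtain ⟨n, hn⟩ := exists_lt_of_lt_ciSup h
    exact ⟨n, hn.trans_le (le_ciSup (f := fun i : Fin (n + 1) => Z i ω)
      (bddAbove_range_fin _ ω) (Fin.last n))⟩
  · rintro ⟨n, hn⟩
    exact hn.trans_le (ciSup_le fun i => le_ciSup (hb ω) i)

variable [MeasurableSpace Ω] {P : Measure Ω}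

theorem measure_lt_iSup_nat
    (hb : ∀ ω, BddAbove (Set.range fun n => Z n ω)) (u : ℝ) :
    P {ω | u < ⨆ n, Z n ω} = ⨆ n : ℕ, P {ω | u < ⨆ i : Fin (n + 1), Z i ω} := by
  rw [setOf_lt_iSup_nat_eq_iUnion hb, Monotone.measure_iUnion]
  intro m n hmn ω hω
  exact lt_of_lt_of_le hω (ciSup_le fun i =>
    le_ciSup (f := fun i : Fin (n + 1) => Z i ω) (bddAbove_range_fin _ ω)
      (Fin.castLE (by omega) i))

theorem exists_map_eq_gaussianReal_of_sequence
    (hZ : ∀ (n : ℕ) (c : Fin n → ℝ), ∃ v, P.map (fun ω => ∑ i, c i * Z i ω) = gaussianReal 0 v)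
    (n : ℕ) : ∃ v, P.map (Z n) = gaussianReal 0 v :=
  exists_map_eq_gaussianReal_of_combo (Y := fun i : Fin (n + 1) => Z i) (hZ (n + 1)) (Fin.last n)

variable [IsProbabilityMeasure P]

/-- The suprema of a centred Gaussian sequence and of its negative have the same tails. -/
theorem gaussian_sequence_sup_neg
    (hZ : ∀ (n : ℕ) (c : Fin n → ℝ), ∃ v, P.map (fun ω => ∑ i, c i * Z i ω) = gaussianReal 0 v)
    (hb : ∀ ω, BddAbove (Set.range fun n => Z n ω))
    (hb' : ∀ ω, BddAbove (Set.range fun n => -Z n ω)) (u : ℝ) :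
    P {ω | u < ⨆ n, -Z n ω} = P {ω | u < ⨆ n, Z n ω} := by
  rw [measure_lt_iSup_nat hb, measure_lt_iSup_nat (Z := fun n ω => -Z n ω) hb']
  congr 1
  ext n
  have hm : AEMeasurable (fun ω (i : Fin (n + 1)) => Z i ω) P := by
    refine aemeasurable_pi_lambda _ fun i => ?_
    obtain ⟨v, hv⟩ := exists_map_eq_gaussianReal_of_sequence hZ i
    exact aemeasurable_of_map_eq_gaussianReal hv
  have hm' : AEMeasurable (fun ω (i : Fin (n + 1)) => -Z i ω) P := hm.neg
  have hset : MeasurableSet {y : Fin (n + 1) → ℝ | u < ⨆ i, y i} :=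
    measurableSet_lt measurable_const (Measurable.iSup measurable_pi_apply)
  have h1 := Measure.map_apply_of_aemeasurable hm hset
  have h2 := Measure.map_apply_of_aemeasurable hm' hset
  rw [map_neg_eq_of_gaussian_vector (Y := fun i : Fin (n + 1) => Z i) (hZ (n + 1)), h1] at h2
  exact h2.symm

/-- Borell–TIS inequality for the supremum of a centred Gaussian sequence. -/
theorem gaussian_sequence_sup_tail
    (hZ : ∀ (n : ℕ) (c : Fin n → ℝ), ∃ v, P.map (fun ω => ∑ i, c i * Z i ω) = gaussianReal 0 v)
    (hb : ∀ ω, BddAbove (Set.range fun n => Z n ω))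
    (hint : Integrable (fun ω => ⨆ n, Z n ω) P) {c : ℝ} (hc : 0 < c)
    (hvar : ∀ n, ∫ ω, Z n ω ^ 2 ∂P ≤ c) {v : ℝ} (hv : ∫ ω, ⨆ n, Z n ω ∂P < v) :
    P {ω | v < ⨆ n, Z n ω} ≤
      ENNReal.ofReal (Real.exp (-(v - ∫ ω, ⨆ n, Z n ω ∂P) ^ 2 / (2 * c))) := by
  rw [measure_lt_iSup_nat hb]
  refine iSup_le fun n => ?_
  have hmem : ∀ k, MemLp (Z k) (1 : NNReal) P := fun k =>
    (exists_map_eq_gaussianReal_of_sequence hZ k).elim fun v hv => memLp_of_map_eq_gaussianReal hv 1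
  have hle : ∀ ω, ⨆ i : Fin (n + 1), Z i ω ≤ ⨆ n, Z n ω := fun ω =>
    ciSup_le fun i => le_ciSup (hb ω) i
  have hge : ∀ ω, Z 0 ω ≤ ⨆ i : Fin (n + 1), Z i ω := fun ω =>
    le_ciSup (f := fun i : Fin (n + 1) => Z i ω) (bddAbove_range_fin _ ω) 0
  have hm : AEMeasurable (fun ω => ⨆ i : Fin (n + 1), Z i ω) P :=
    AEMeasurable.iSup fun i => (hmem i).aestronglyMeasurable.aemeasurable
  have hZ0 : Integrable (Z 0) P := memLp_one_iff_integrable.1 (by simpa using hmem 0)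
  have hintn : Integrable (fun ω => ⨆ i : Fin (n + 1), Z i ω) P := by
    refine (hZ0.abs.add hint.abs).mono' hm.aestronglyMeasurable (ae_of_all _ fun ω => ?_)
    rw [Real.norm_eq_abs, abs_le]
    have := hle ω
    have := hge ω
    simp only [Pi.add_apply]
    constructor
    · linarith [neg_abs_le (Z 0 ω), abs_nonneg (⨆ n, Z n ω)]
    · linarith [le_abs_self (⨆ n, Z n ω), abs_nonneg (Z 0 ω)]
  have hmean : ∫ ω, ⨆ i : Fin (n + 1), Z i ω ∂P ≤ ∫ ω, ⨆ n, Z n ω ∂P :=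
    integral_mono hintn hint hle
  refine (gaussian_vector_max_tail (Y := fun i : Fin (n + 1) => Z i) (hZ (n + 1)) hc
    (fun i => hvar i) (hmean.trans_lt hv)).trans ?_
  gcongr

end GaussianSequence

section GaussianVariable

variable {Ω : Type*} [MeasurableSpace Ω] {P : Measure Ω}

theorem measure_lt_pos_of_map_eq_gaussianReal {Z : Ω → ℝ} {v : NNReal}
    (h : P.map Z = gaussianReal 0 v) (hv : v ≠ 0) (u : ℝ) : 0 < P {ω | u < Z ω} := by
  have h1 : P {ω | u < Z ω} = gaussianReal 0 v (Set.Ioi u) := by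
    rw [← h, Measure.map_apply_of_aemeasurable (aemeasurable_of_map_eq_gaussianReal h)
      measurableSet_Ioi]
    rfl
  rw [h1, pos_iff_ne_zero]
  intro h0
  simpa using gaussianReal_absolutelyContinuous' 0 hv h0

theorem integral_abs_gaussianReal_pos : 0 < ∫ x, |x| ∂(gaussianReal 0 1) := by
  have hint : Integrable (fun x : ℝ => |x|) (gaussianReal 0 1) :=
    ((memLp_one_iff_integrable (f := id)).1
      (by simpa using memLp_id_gaussianReal (μ := 0) (v := 1) 1)).abs
  rw [integral_pos_iff_support_of_nonneg (fun x => abs_nonneg x) hint, pos_iff_ne_zero]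
  intro h0
  have h1 := gaussianReal_absolutelyContinuous' 0 one_ne_zero h0
  have h2 : Set.Ioi (0 : ℝ) ⊆ Function.support fun x : ℝ => |x| := fun x hx =>
    abs_ne_zero.2 (ne_of_gt hx)
  simpa using measure_mono_null h2 h1

theorem integral_abs_of_map_eq_gaussianReal {Z : Ω → ℝ} {v : NNReal}
    (h : P.map Z = gaussianReal 0 v) :
    ∫ ω, |Z ω| ∂P = √(v : ℝ) * ∫ x, |x| ∂(gaussianReal 0 1) := by
  have hsc : (gaussianReal 0 1).map (fun x => √(v : ℝ) * x) = gaussianReal 0 v := by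
    rw [gaussianReal_map_const_mul]
    congr 1
    · simp
    · ext
      simp
  have hm : AEStronglyMeasurable (fun x : ℝ => |x|) (gaussianReal 0 v) :=
    continuous_abs.aestronglyMeasurable
  have h1 : ∫ ω, |Z ω| ∂P = ∫ x, |x| ∂(P.map Z) :=
    (integral_map (aemeasurable_of_map_eq_gaussianReal h) (h ▸ hm)).symm
  rw [h1, h, ← hsc, integral_map (by fun_prop) (hsc ▸ hm), ← integral_const_mul]
  simp only [abs_mul, abs_of_nonneg (Real.sqrt_nonneg _)]

/-- Centred Gaussian variables with a common nonnegative integrable upper bound have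
uniformly bounded variances. -/
theorem exists_forall_integral_sq_le_of_gaussian_le {M : Ω → ℝ} (hM : Integrable M P)
    (hM0 : ∀ ω, 0 ≤ M ω) : ∃ C, ∀ (Z : Ω → ℝ) (v : NNReal), P.map Z = gaussianReal 0 v →
      (∀ ω, Z ω ≤ M ω) → ∫ ω, Z ω ^ 2 ∂P ≤ C := by
  refine ⟨(2 * (∫ ω, M ω ∂P) / ∫ x, |x| ∂(gaussianReal 0 1)) ^ 2, fun Z v h hle => ?_⟩
  have hk := integral_abs_gaussianReal_pos
  have hZ : Integrable Z P :=
    memLp_one_iff_integrable.1 (by simpa using memLp_of_map_eq_gaussianReal h 1)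
  have habs : ∫ ω, |Z ω| ∂P ≤ 2 * ∫ ω, M ω ∂P := by
    have : ∫ ω, |Z ω| ∂P ≤ ∫ ω, (2 * M ω - Z ω) ∂P :=
      integral_mono hZ.abs ((hM.const_mul 2).sub hZ) fun ω =>
        abs_le.2 ⟨by linarith [hM0 ω], by linarith [hle ω]⟩
    rwa [integral_sub (hM.const_mul 2) hZ, integral_of_map_eq_gaussianReal h, sub_zero,
      integral_const_mul] at this
  rw [integral_abs_of_map_eq_gaussianReal h] at habs
  rw [integral_sq_of_map_eq_gaussianReal h, ← Real.sq_sqrt v.coe_nonneg]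
  gcongr
  rwa [le_div_iff₀ hk]

end GaussianVariable

section ExitProbability

variable {Ω : Type*} [MeasurableSpace Ω] {P : Measure Ω} {M N : Ω → ℝ}

theorem integrableOn_measureReal_lt (hM : Integrable M P) (hM0 : ∀ ω, 0 ≤ M ω) :
    IntegrableOn (fun u => P.real {ω | u < M ω}) (Set.Ioi 0) := by
  refine integrable_toReal_of_lintegral_ne_top (Antitone.measurable ?_).aemeasurable ?_
  · exact fun u v huv => measure_mono fun ω hω => huv.trans_lt hω
  · rw [← lintegral_eq_lintegral_meas_lt P (ae_of_all _ hM0) hM.aemeasurable]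
    exact hM.lintegral_lt_top.ne

theorem ae_measure_le_eq_measure_lt (M N : Ω → ℝ) (a b : ℝ) :
    ∀ᵐ x : ℝ, P {ω | b - x ≤ M ω} = P {ω | b - x < M ω} ∧
      P {ω | x - a ≤ N ω} = P {ω | x - a < N ω} := by
  have h1 := (Measure.measurePreserving_sub_left volume b).quasiMeasurePreserving.ae
    (meas_le_ae_eq_meas_lt P volume M)
  have h2 := (measurePreserving_sub_right volume a).quasiMeasurePreserving.ae
    (meas_le_ae_eq_meas_lt P volume N)
  filter_upwards [h1, h2] with x hx hx' using ⟨hx, hx'⟩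

variable [IsProbabilityMeasure P]

theorem antitone_measureReal_lt (M : Ω → ℝ) : Antitone fun u => P.real {ω | u < M ω} :=
  fun _ _ huv => measureReal_mono fun _ hω => huv.trans_lt hω

theorem measurable_measure_le_and_le (hM : AEMeasurable M P) (hN : AEMeasurable N P) (a b : ℝ) :
    Measurable fun x => P {ω | b - x ≤ M ω ∧ x - a ≤ N ω} := by
  have hset : MeasurableSet {p : ℝ × Ω | b - p.1 ≤ hM.mk M p.2 ∧ p.1 - a ≤ hN.mk N p.2} :=
    (measurableSet_le (measurable_const.sub measurable_fst)
      (hM.measurable_mk.comp measurable_snd)).inter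
    (measurableSet_le (measurable_fst.sub measurable_const)
      (hN.measurable_mk.comp measurable_snd))
  convert measurable_measure_prodMk_left (ν := P) hset using 1
  ext x
  refine measure_congr ?_
  filter_upwards [hM.ae_eq_mk, hN.ae_eq_mk] with ω h1 h2
  refine propext ?_
  show (b - x ≤ M ω ∧ x - a ≤ N ω) ↔ (b - x ≤ hM.mk M ω ∧ x - a ≤ hN.mk N ω)
  rw [h1, h2]

/-- Inclusion-exclusion for an event caught between the strict and the weak version of
`M ≤ u` and `N ≤ v`, at levels that are not atoms. -/
theorem measureReal_eq_of_sandwich (hM : AEMeasurable M P) (hN : AEMeasurable N P)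
    {u v : ℝ} {E : Set Ω} (hE : {ω | M ω < u ∧ N ω < v} ⊆ E)
    (hE' : E ⊆ {ω | M ω ≤ u ∧ N ω ≤ v})
    (hu : P {ω | u ≤ M ω} = P {ω | u < M ω}) (hv : P {ω | v ≤ N ω} = P {ω | v < N ω}) :
    P.real E = 1 - P.real {ω | u < M ω} - P.real {ω | v < N ω} +
      P.real {ω | u ≤ M ω ∧ v ≤ N ω} := by
  have nA : NullMeasurableSet {ω | u ≤ M ω} P := nullMeasurableSet_le aemeasurable_const hM
  have nB : NullMeasurableSet {ω | v ≤ N ω} P := nullMeasurableSet_le aemeasurable_const hN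
  have nA' : NullMeasurableSet {ω | u < M ω} P := nullMeasurableSet_lt aemeasurable_const hM
  have nB' : NullMeasurableSet {ω | v < N ω} P := nullMeasurableSet_lt aemeasurable_const hN
  have eA : {ω | u < M ω} =ᵐ[P] {ω | u ≤ M ω} :=
    ae_eq_of_subset_of_measure_ge (fun ω (h : u < M ω) => h.le) hu.le nA' (measure_ne_top _ _)
  have eB : {ω | v < N ω} =ᵐ[P] {ω | v ≤ N ω} :=
    ae_eq_of_subset_of_measure_ge (fun ω (h : v < N ω) => h.le) hv.le nB' (measure_ne_top _ _)
  have hP : P.real E = P.real ({ω | u ≤ M ω} ∪ {ω | v ≤ N ω})ᶜ := by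
    refine le_antisymm ?_ (measureReal_mono fun ω hω => hE ?_)
    · rw [← measureReal_congr (eA.union eB).compl]
      refine measureReal_mono fun ω hω => ?_
      have := hE' hω
      simp only [Set.mem_compl_iff, Set.mem_union, Set.mem_ofPred_eq, not_or, not_lt] at this ⊢
      exact this
    · simpa using hω
  have huv := measureReal_union_add_inter₀ (μ := P) (s := {ω | u ≤ M ω}) nB
  have eu : P.real {ω | u ≤ M ω} = P.real {ω | u < M ω} := congrArg ENNReal.toReal hu
  have ev : P.real {ω | v ≤ N ω} = P.real {ω | v < N ω} := congrArg ENNReal.toReal hv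
  have ei : {ω | u ≤ M ω ∧ v ≤ N ω} = {ω | u ≤ M ω} ∩ {ω | v ≤ N ω} := rfl
  rw [hP, probReal_compl_eq_one_sub₀ (nA.union nB), ei, ← eu, ← ev]
  linarith

theorem intervalIntegrable_measureReal_le_and_le (hM : AEMeasurable M P) (hN : AEMeasurable N P)
    (a b c d : ℝ) :
    IntervalIntegrable (fun x => P.real {ω | b - x ≤ M ω ∧ x - a ≤ N ω}) volume c d :=
  (intervalIntegrable_const (c := (1 : ℝ))).mono_fun
    (measurable_measure_le_and_le hM hN a b).ennreal_toReal.aestronglyMeasurable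
    (ae_of_all _ fun x => by
      simp only [Real.norm_of_nonneg measureReal_nonneg, norm_one]
      exact measureReal_le_one)

/-- The deficit of the heat content equals twice the mean of the supremum, minus the error. -/
theorem integral_exit_eq {a b : ℝ} (hab : a < b) (hM : Integrable M P) (hM0 : ∀ ω, 0 ≤ M ω)
    (hN : AEMeasurable N P) (hsymm : ∀ u, P {ω | u < N ω} = P {ω | u < M ω}) {E : ℝ → Set Ω}
    (hE : ∀ x, {ω | M ω < b - x ∧ N ω < x - a} ⊆ E x)
    (hE' : ∀ x, E x ⊆ {ω | M ω ≤ b - x ∧ N ω ≤ x - a}) :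
    (b - a) - ∫ x in Set.Ioo a b, P.real (E x) = 2 * (∫ ω, M ω ∂P) -
      (2 * (∫ u in Set.Ioi (b - a), P.real {ω | u < M ω}) +
        ∫ x in Set.Ioo a b, P.real {ω | b - x ≤ M ω ∧ x - a ≤ N ω}) := by
  simp only [← integral_Ioc_eq_integral_Ioo, ← intervalIntegral.integral_of_le hab.le]
  set g : ℝ → ℝ := fun u => P.real {ω | u < M ω} with hg
  have hgi : ∀ c d, IntervalIntegrable g volume c d := fun c d =>
    (antitone_measureReal_lt M).intervalIntegrable
  have hJ := intervalIntegrable_measureReal_le_and_le hM.aemeasurable hN a b a b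
  have h1 : ∫ x in a..b, P.real (E x) = ∫ x in a..b, (1 - g (b - x) - g (x - a) +
      P.real {ω | b - x ≤ M ω ∧ x - a ≤ N ω}) := by
    refine intervalIntegral.integral_congr_ae ?_
    filter_upwards [ae_measure_le_eq_measure_lt (P := P) M N a b] with x hx _
    rw [measureReal_eq_of_sandwich hM.aemeasurable hN (hE x) (hE' x) hx.1 hx.2]
    simp only [hg, measureReal_def, hsymm]
  have i1 : IntervalIntegrable (fun x => g (b - x)) volume a b := by
    simpa using (hgi (b - a) (b - b)).comp_sub_left b
  have i2 : IntervalIntegrable (fun x => g (x - a)) volume a b := by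
    simpa using (hgi (a - a) (b - a)).comp_sub_right a
  have h0 : IntervalIntegrable (fun _ : ℝ => (1 : ℝ)) volume a b := intervalIntegrable_const
  rw [h1, intervalIntegral.integral_add ((h0.sub i1).sub i2) hJ,
    intervalIntegral.integral_sub (h0.sub i1) i2, intervalIntegral.integral_sub h0 i1,
    intervalIntegral.integral_comp_sub_left g, intervalIntegral.integral_comp_sub_right g,
    sub_self, sub_self, hM.integral_eq_integral_meas_lt (ae_of_all _ hM0),
    ← intervalIntegral.integral_interval_add_Ioi (integrableOn_measureReal_lt hM hM0)
      ((integrableOn_measureReal_lt hM hM0).mono_set (Set.Ioi_subset_Ioi (sub_pos.2 hab).le)),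
    intervalIntegral.integral_const, smul_eq_mul]
  ring

/-- Probability of reaching both ends, integrated over the starting point. -/
theorem integral_both_exits_le {a b : ℝ} (hab : a < b) (hM : Integrable M P)
    (hM0 : ∀ ω, 0 ≤ M ω) (hN : AEMeasurable N P)
    (hsymm : ∀ u, P {ω | u < N ω} = P {ω | u < M ω}) :
    ∫ x in Set.Ioo a b, P.real {ω | b - x ≤ M ω ∧ x - a ≤ N ω} ≤
      2 * ∫ u in Set.Ioi ((b - a) / 2), P.real {ω | u < M ω} := by
  rw [← integral_Ioc_eq_integral_Ioo, ← intervalIntegral.integral_of_le hab.le]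
  set g : ℝ → ℝ := fun u => P.real {ω | u < M ω} with hg
  have hgi : ∀ c d, IntervalIntegrable g volume c d := fun c d =>
    (antitone_measureReal_lt M).intervalIntegrable
  have hJ := intervalIntegrable_measureReal_le_and_le hM.aemeasurable hN a b
  obtain ⟨m, rfl⟩ : ∃ m, b = 2 * m - a := ⟨(a + b) / 2, by ring⟩
  have ham : a ≤ m := by linarith
  have hmb : m ≤ 2 * m - a := by linarith
  have hae := ae_measure_le_eq_measure_lt (P := P) M N a (2 * m - a)
  have h1 : ∫ x in a..m, P.real {ω | 2 * m - a - x ≤ M ω ∧ x - a ≤ N ω} ≤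
      ∫ x in a..m, g (2 * m - a - x) := by
    refine intervalIntegral.integral_mono_ae ham (hJ _ _) ?_ ?_
    · simpa using (hgi (2 * m - a - a) (2 * m - a - m)).comp_sub_left (2 * m - a)
    · filter_upwards [hae] with x hx
      exact (measureReal_mono (μ := P) fun ω (h : _ ∧ _) => h.1).trans_eq
        (congrArg ENNReal.toReal hx.1)
  have h2 : ∫ x in m..2 * m - a, P.real {ω | 2 * m - a - x ≤ M ω ∧ x - a ≤ N ω} ≤
      ∫ x in m..2 * m - a, g (x - a) := by
    refine intervalIntegral.integral_mono_ae hmb (hJ _ _) ?_ ?_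
    · simpa using (hgi (m - a) (2 * m - a - a)).comp_sub_right a
    · filter_upwards [hae] with x hx
      exact (measureReal_mono (μ := P) fun ω (h : _ ∧ _) => h.2).trans_eq
        (congrArg ENNReal.toReal (hx.2.trans (hsymm _)))
  rw [← intervalIntegral.integral_add_adjacent_intervals (hJ a m) (hJ m _)]
  rw [intervalIntegral.integral_comp_sub_left g] at h1
  rw [intervalIntegral.integral_comp_sub_right g] at h2
  have hI := integrableOn_measureReal_lt hM hM0
  have hpos : 0 ≤ m - a := by linarith
  have h3 := intervalIntegral.integral_interval_add_Ioi
    (hI.mono_set (Set.Ioi_subset_Ioi hpos))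
    (hI.mono_set (Set.Ioi_subset_Ioi (by linarith : 0 ≤ 2 * m - a - a)))
  have h4 : 0 ≤ ∫ u in Set.Ioi (2 * m - a - a), g u :=
    integral_nonneg fun u => measureReal_nonneg
  have e1 : 2 * m - a - m = m - a := by ring
  have e2 : (2 * m - a - a) / 2 = m - a := by ring
  rw [e1] at h1
  rw [e2]
  linarith

end ExitProbability

section GaussianIntegral

theorem integrableOn_and_integral_gaussian_tail_le {s c m : ℝ} (hs : 0 < s) (hc : m < c) :
    IntegrableOn (fun u => (u - m) / (c - m) * Real.exp (-(u - m) ^ 2 / (2 * s))) (Set.Ioi c) ∧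
      ∫ u in Set.Ioi c, (u - m) / (c - m) * Real.exp (-(u - m) ^ 2 / (2 * s)) =
        s / (c - m) * Real.exp (-(c - m) ^ 2 / (2 * s)) := by
  have hcm : 0 < c - m := sub_pos.2 hc
  have hderiv : ∀ x ∈ Set.Ici c, HasDerivAt
      (fun u => -(s / (c - m)) * Real.exp (-(u - m) ^ 2 / (2 * s)))
      ((x - m) / (c - m) * Real.exp (-(x - m) ^ 2 / (2 * s))) x := by
    intro x _
    have h := (((((hasDerivAt_id x).sub_const m).pow 2).neg.div_const (2 * s)).exp).const_mul
      (-(s / (c - m)))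
    refine h.congr_deriv ?_
    simp only [id, Pi.neg_apply, Pi.pow_apply]
    push_cast
    field_simp
  have hpos : ∀ x ∈ Set.Ioi c, 0 ≤ (x - m) / (c - m) * Real.exp (-(x - m) ^ 2 / (2 * s)) :=
    fun x (hx : c < x) => mul_nonneg (div_nonneg (by linarith) hcm.le) (Real.exp_pos _).le
  have hlim : Tendsto (fun u => -(s / (c - m)) * Real.exp (-(u - m) ^ 2 / (2 * s))) atTop
      (nhds 0) := by
    rw [← mul_zero (-(s / (c - m)))]
    refine (Real.tendsto_exp_atBot.comp ?_).const_mul _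
    refine Tendsto.atBot_div_const (by positivity) (tendsto_neg_atTop_atBot.comp ?_)
    exact (tendsto_pow_atTop two_ne_zero).comp (tendsto_atTop_add_const_right _ (-m) tendsto_id)
  refine ⟨integrableOn_Ioi_deriv_of_nonneg' hderiv hpos hlim, ?_⟩
  rw [integral_Ioi_of_hasDerivAt_of_nonneg' hderiv hpos hlim]
  ring

theorem setIntegral_Ioi_le_of_gaussian_tail {g : ℝ → ℝ} {s c m : ℝ} (hs : 0 < s) (hc : m < c)
    (hg : IntegrableOn g (Set.Ioi c))
    (hle : ∀ u, m < u → g u ≤ Real.exp (-(u - m) ^ 2 / (2 * s))) :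
    ∫ u in Set.Ioi c, g u ≤ s / (c - m) * Real.exp (-(c - m) ^ 2 / (2 * s)) := by
  obtain ⟨hi, he⟩ := integrableOn_and_integral_gaussian_tail_le hs hc
  rw [← he]
  refine setIntegral_mono_on hg hi measurableSet_Ioi fun u (hu : c < u) => ?_
  refine (hle u (hc.trans hu)).trans (le_mul_of_one_le_left (Real.exp_pos _).le ?_)
  rw [one_le_div (sub_pos.2 hc)]
  linarith

end GaussianIntegral

/-- Exact expression and error bound for the spectral heat content of a
zero-mean Gaussian process on an interval `D = (a,b)`. -/
theorem spectral_heat_content_gaussian_exact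
    {Ω : Type*} [MeasureSpace Ω] [IsProbabilityMeasure (ℙ : Measure Ω)]
    (a b : ℝ) (hab : a < b) (X : ℝ → Ω → ℝ)
    (hGauss : IsZeroMeanGaussianProcess X)
    (hpath : ∀ ω, IsCadlagPath (fun s => X s ω))
    (hX0 : ∀ ω, X 0 ω = 0)
    (hnondeg : ∀ t ∈ Set.Ioc (0:ℝ) 1, 0 < ℙ {ω | X t ω ≠ 0})
    (hμfin : ∀ t ∈ Set.Ioc (0:ℝ) 1,
      Integrable (fun ω => ⨆ s : Set.Icc (0:ℝ) t, X s.1 ω) ℙ)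
    (μ σsq Q ErrQ : ℝ → ℝ)
    (hμ : ∀ t, μ t = ∫ ω, (⨆ s : Set.Icc (0:ℝ) t, X s.1 ω) ∂ℙ)
    (hσsq : ∀ t, σsq t = ⨆ s : Set.Icc (0:ℝ) t, ∫ ω, (X s.1 ω) ^ 2 ∂ℙ)
    (hQ : ∀ t, Q t = ∫ x in Set.Ioo a b,
      (ℙ {ω | ∀ s ∈ Set.Icc (0:ℝ) t, X s ω + x ∈ Set.Ioo a b}).toReal)
    (hErrQ : ∀ t, ErrQ t =
      2 * (∫ u in Set.Ioi (b - a), (ℙ {ω | u < ⨆ s : Set.Icc (0:ℝ) t, X s.1 ω}).toReal)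
      + ∫ x in Set.Ioo a b,
          (ℙ {ω | b - x ≤ (⨆ s : Set.Icc (0:ℝ) t, X s.1 ω) ∧
                  (⨅ s : Set.Icc (0:ℝ) t, X s.1 ω) ≤ a - x}).toReal) :
    ∀ t ∈ Set.Ioc (0:ℝ) 1, μ t < (b - a) / 2 →
      ((b - a) - Q t = 2 * μ t - ErrQ t ∧
       0 < ErrQ t ∧
       ErrQ t ≤ 4 * σsq t / ((b - a) - μ t) *
            Real.exp (-((b - a) - μ t) ^ 2 / (2 * σsq t))
          + 4 * σsq t / ((b - a) / 2 - μ t) *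
            Real.exp (-((b - a) / 2 - μ t) ^ 2 / (2 * σsq t))) := by
  intro t ht hμt
  obtain ⟨q, hq0, hq, hqd⟩ := exists_seq_dense_Icc ht.1
  set M : Ω → ℝ := fun ω => ⨆ s : Set.Icc (0 : ℝ) t, X s.1 ω with hM
  set N : Ω → ℝ := fun ω => -⨅ s : Set.Icc (0 : ℝ) t, X s.1 ω with hN
  have hMint : Integrable M ℙ := hμfin t ht
  have hbdd : ∀ ω, BddAbove (Set.range fun s : Set.Icc (0 : ℝ) t => X s.1 ω) := fun ω =>
    (hpath ω).bddAbove_range ht.2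
  have hbdd' : ∀ ω, BddAbove (Set.range fun s : Set.Icc (0 : ℝ) t => -X s.1 ω) := fun ω =>
    (hpath ω).neg.bddAbove_range ht.2
  have hNsup : ∀ ω, N ω = ⨆ s : Set.Icc (0 : ℝ) t, -X s.1 ω := fun ω =>
    neg_iInf_Icc_eq_iSup_neg (fun s => X s ω) t
  have hXM : ∀ s ∈ Set.Icc (0 : ℝ) t, ∀ ω, X s ω ≤ M ω := fun s hs ω =>
    le_ciSup (hbdd ω) ⟨s, hs⟩
  have hXN : ∀ s ∈ Set.Icc (0 : ℝ) t, ∀ ω, -X s ω ≤ N ω := fun s hs ω =>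
    hNsup ω ▸ le_ciSup (hbdd' ω) ⟨s, hs⟩
  have hM0 : ∀ ω, 0 ≤ M ω := fun ω => hX0 ω ▸ hXM 0 ⟨le_rfl, ht.1.le⟩ ω
  have hMq : M = fun ω => ⨆ n, X (q n) ω :=
    funext fun ω => (hpath ω).iSup_eq_iSup_seq ht.2 hq0 hq hqd
  have hNq : N = fun ω => ⨆ n, -X (q n) ω :=
    funext fun ω => (hNsup ω).trans ((hpath ω).neg.iSup_eq_iSup_seq ht.2 hq0 hq hqd)
  have hZ : ∀ (n : ℕ) (c : Fin n → ℝ), ∃ v,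
      Measure.map (fun ω => ∑ i, c i * X (q i) ω) ℙ = gaussianReal 0 v := fun n c =>
    hGauss n (fun i => q i) (fun i => ⟨(hq i).1, (hq i).2.trans ht.2⟩) c
  have hb : ∀ ω, BddAbove (Set.range fun n => X (q n) ω) := fun ω => by
    refine ⟨M ω, ?_⟩
    rintro _ ⟨n, rfl⟩
    exact hXM _ (hq n) ω
  have hb' : ∀ ω, BddAbove (Set.range fun n => -X (q n) ω) := fun ω => by
    refine ⟨N ω, ?_⟩
    rintro _ ⟨n, rfl⟩
    exact hXN _ (hq n) ω
  have hXmap : ∀ s ∈ Set.Icc (0 : ℝ) t, ∃ v, Measure.map (X s) ℙ = gaussianReal 0 v := by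
    intro s hs
    simpa using hGauss 1 (fun _ => s) (fun _ => ⟨hs.1, hs.2.trans ht.2⟩) (fun _ => 1)
  have hNm : AEMeasurable N ℙ := by
    rw [hNq]
    refine AEMeasurable.iSup fun n => ?_
    obtain ⟨v, hv⟩ := hXmap _ (hq n)
    exact (aemeasurable_of_map_eq_gaussianReal hv).neg
  have hsymm : ∀ u, ℙ {ω | u < N ω} = ℙ {ω | u < M ω} := fun u => by
    rw [hMq, hNq]
    exact gaussian_sequence_sup_neg (Z := fun n => X (q n)) hZ hb hb' u
  have hvbdd : BddAbove (Set.range fun s : Set.Icc (0 : ℝ) t => ∫ ω, X s.1 ω ^ 2 ∂ℙ) := by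
    obtain ⟨C, hC⟩ := exists_forall_integral_sq_le_of_gaussian_le hMint hM0
    refine ⟨C, ?_⟩
    rintro _ ⟨s, rfl⟩
    obtain ⟨v, hv⟩ := hXmap s.1 s.2
    exact hC _ v hv (hXM s.1 s.2)
  have hvar : ∀ s ∈ Set.Icc (0 : ℝ) t, ∫ ω, X s ω ^ 2 ∂ℙ ≤ σsq t := fun s hs =>
    hσsq t ▸ le_ciSup hvbdd ⟨s, hs⟩
  have htt : t ∈ Set.Icc (0 : ℝ) t := ⟨ht.1.le, le_rfl⟩
  obtain ⟨v, hv⟩ := hXmap t htt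
  have hv0 : v ≠ 0 := by
    rintro rfl
    refine (hnondeg t ht).ne' ?_
    have h0 : MeasurableSet {x : ℝ | x ≠ 0} := (measurableSet_singleton 0).compl
    have h1 := Measure.map_apply_of_aemeasurable (aemeasurable_of_map_eq_gaussianReal hv) h0
    rw [hv, gaussianReal_zero_var, Measure.dirac_apply' _ h0] at h1
    simpa using h1.symm
  have hσpos : 0 < σsq t :=
    (NNReal.coe_pos.2 (pos_iff_ne_zero.2 hv0)).trans_le
      (integral_sq_of_map_eq_gaussianReal hv ▸ hvar t htt)
  have htail : ∀ u, μ t < u → (ℙ : Measure Ω).real {ω | u < M ω} ≤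
      Real.exp (-(u - μ t) ^ 2 / (2 * σsq t)) := fun u hu => by
    refine ENNReal.toReal_le_of_le_ofReal (Real.exp_pos _).le ?_
    have hmean : μ t = ∫ ω, ⨆ n, X (q n) ω ∂ℙ := by rw [hμ, ← hMq]
    rw [hmean] at hu ⊢
    rw [hMq]
    exact gaussian_sequence_sup_tail (Z := fun n => X (q n)) hZ hb (hMq ▸ hMint) hσpos
      (fun n => hvar _ (hq n)) hu
  have hJ : ∀ x, {ω | b - x ≤ M ω ∧ (⨅ s : Set.Icc (0 : ℝ) t, X s.1 ω) ≤ a - x} =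
      {ω | b - x ≤ M ω ∧ x - a ≤ N ω} := fun x => by
    ext ω
    simp only [Set.mem_ofPred_eq, hN]
    refine and_congr_right fun _ => ?_
    rw [le_neg, neg_sub]
  have hErr : ErrQ t = 2 * (∫ u in Set.Ioi (b - a), (ℙ : Measure Ω).real {ω | u < M ω}) +
      ∫ x in Set.Ioo a b, (ℙ : Measure Ω).real {ω | b - x ≤ M ω ∧ x - a ≤ N ω} := by
    rw [hErrQ]
    simp only [← hJ]
    rfl
  have hD : 0 < b - a := sub_pos.2 hab
  have hgi := integrableOn_measureReal_lt hMint hM0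
  have hgi' : ∀ c, 0 < c → IntegrableOn (fun u => (ℙ : Measure Ω).real {ω | u < M ω})
      (Set.Ioi c) := fun c hc => hgi.mono_set (Set.Ioi_subset_Ioi hc.le)
  refine ⟨?_, ?_, ?_⟩
  · rw [hErr, hQ, hμ]
    refine integral_exit_eq hab hMint hM0 hNm hsymm (fun x ω hω s hs => ?_) fun x ω hω => ?_
    · have h1 := hXM s hs ω
      have h2 := hXN s hs ω
      exact ⟨by linarith [hω.2], by linarith [hω.1]⟩
    · have : Nonempty (Set.Icc (0 : ℝ) t) := ⟨⟨t, htt⟩⟩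
      refine ⟨ciSup_le fun s => ?_, hNsup ω ▸ ciSup_le fun s => ?_⟩
      · linarith [(hω s.1 s.2).2]
      · linarith [(hω s.1 s.2).1]
  · rw [hErr]
    refine add_pos_of_pos_of_nonneg (mul_pos two_pos ?_)
      (integral_nonneg fun x => measureReal_nonneg)
    rw [setIntegral_pos_iff_support_of_nonneg_ae (ae_of_all _ fun u => measureReal_nonneg)
      (hgi' _ hD)]
    refine lt_of_lt_of_le ?_ (measure_mono (s := Set.Ioi (b - a)) fun u hu => ⟨?_, hu⟩)
    · simp
    · refine (ENNReal.toReal_pos (ne_of_gt ?_) (measure_ne_top _ _)).ne'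
      exact (measure_lt_pos_of_map_eq_gaussianReal hv hv0 u).trans_le
        (measure_mono fun ω hω => lt_of_lt_of_le hω (hXM t htt ω))
  · have h1 := setIntegral_Ioi_le_of_gaussian_tail hσpos (by linarith : μ t < b - a)
      (hgi' _ hD) htail
    have h2 := setIntegral_Ioi_le_of_gaussian_tail hσpos hμt (hgi' _ (half_pos hD)) htail
    have h3 := integral_both_exits_le hab hMint hM0 hNm hsymm
    have p1 : 0 ≤ σsq t / ((b - a) - μ t) *
        Real.exp (-((b - a) - μ t) ^ 2 / (2 * σsq t)) :=
      mul_nonneg (div_nonneg hσpos.le (by linarith)) (Real.exp_pos _).le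
    have p2 : 0 ≤ σsq t / ((b - a) / 2 - μ t) *
        Real.exp (-((b - a) / 2 - μ t) ^ 2 / (2 * σsq t)) :=
      mul_nonneg (div_nonneg hσpos.le (by linarith)) (Real.exp_pos _).le
    rw [hErr, mul_div_assoc, mul_div_assoc, mul_assoc, mul_assoc]
    linarith
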